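/- For any k-bounded partition λ with |λ| ≤ k, the k-K-Schur function equals the dual Grothendieck polynomial: g^{(k)}_λ = g_λ in Λ. -/

import Mathlib

open scoped Classical

namespace AffineKTheory

noncomputable instance : Nonempty YoungDiagram := ⟨⊥⟩

noncomputable instance : Nonempty YoungDiagram := ⟨⊥⟩

/-! ## Cells, hooks, cores, residues -/

/-- Hook length of the cell `(r, c)` in the diagram `γ`. -/
def hookLen (γ : YoungDiagram) (r c : ℕ) : ℕ :=
  (γ.rowLen r - c) + (γ.colLen c - r) - 1

/-- A `p`-core: a diagram none of whose cells has hook length `p`. -/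
def IsCore (p : ℕ) (γ : YoungDiagram) : Prop :=
  ∀ c : ℕ × ℕ, c ∈ γ → hookLen γ c.1 c.2 ≠ p

/-- The `(k+1)`-residue of a cell.  (Rows of the Ferrers shape are indexed so that the cell
directly above `(r, c)` -- in the Ferrers sense of the next, shorter, row -- is `(r+1, c)`.) -/
def residue (k : ℕ) (c : ℕ × ℕ) : ZMod (k + 1) :=
  (c.2 : ZMod (k + 1)) - (c.1 : ZMod (k + 1))

/-- A removable corner of `γ`: a cell of `γ` with no cell above it nor to its right. -/
def Removable (γ : YoungDiagram) (c : ℕ × ℕ) : Prop :=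
  c ∈ γ ∧ (c.1 + 1, c.2) ∉ γ ∧ (c.1, c.2 + 1) ∉ γ

/-- An addable corner of `γ`: a cell outside `γ` whose addition again yields a partition shape. -/
def Addable (γ : YoungDiagram) (c : ℕ × ℕ) : Prop :=
  c ∉ γ ∧ ∀ d : ℕ × ℕ, d ≤ c → d ≠ c → d ∈ γ

/-- A cell is `γ`-blocked if it lies below a cell of `γ`. -/
def Blocked (γ : YoungDiagram) (c : ℕ × ℕ) : Prop :=
  (c.1 + 1, c.2) ∈ γ

/-- The number of cells of `γ` in row `i` whose hook length is at most `k`: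
the `i`-th part of `𝔭(γ)`. -/
noncomputable def pRow (k : ℕ) (γ : YoungDiagram) (i : ℕ) : ℕ :=
  (γ.cells.filter (fun c => c.1 = i ∧ hookLen γ c.1 c.2 ≤ k)).card

/-- The number of cells of `γ` with `k`-bounded hook length, i.e. `|𝔭(γ)|`. -/
noncomputable def pSize (k : ℕ) (γ : YoungDiagram) : ℕ :=
  (γ.cells.filter (fun c => hookLen γ c.1 c.2 ≤ k)).card

/-- A `k`-bounded partition: all parts at most `k`. -/
def IsKBounded (k : ℕ) (lam : YoungDiagram) : Prop :=
  ∀ i, lam.rowLen i ≤ k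

/-- `𝔭(γ)`: the `k`-bounded partition obtained from a `(k+1)`-core `γ` by deleting every cell of
hook length greater than `k` and reading off row lengths. -/
noncomputable def pPart (k : ℕ) (γ : YoungDiagram) : YoungDiagram :=
  Classical.epsilon fun lam => ∀ i, lam.rowLen i = pRow k γ i

/-- `𝔠(λ)`: the unique `(k+1)`-core corresponding to the `k`-bounded partition `λ` under the
bijection `𝔭`. -/
noncomputable def coreOf (k : ℕ) (lam : YoungDiagram) : YoungDiagram :=
  Classical.epsilon fun γ => IsCore (k + 1) γ ∧ ∀ i, pRow k γ i = lam.rowLen i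

/-- The `k`-conjugate `λ^{ω_k} = 𝔭(𝔠(λ)')` of a `k`-bounded partition. -/
noncomputable def kConj (k : ℕ) (lam : YoungDiagram) : YoungDiagram :=
  pPart k ((coreOf k lam).transpose)

/-- A `k`-bounded composition: a list of parts, each between `1` and `k`. -/
def IsKBoundedComp (k : ℕ) (α : List ℕ) : Prop :=
  ∀ a ∈ α, 1 ≤ a ∧ a ≤ k

/-- Dominance order on partitions. -/
def Dominates (mu lam : YoungDiagram) : Prop :=
  mu.card = lam.card ∧
    ∀ n : ℕ, ∑ i ∈ Finset.range n, lam.rowLen i ≤ ∑ i ∈ Finset.range n, mu.rowLen i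


/-! ## Set-valued fillings and affine set-valued tableaux -/

/-- A set-valued filling of the shape `γ`: each cell of `γ` carries a finite nonempty set of
positive integers, empty outside `γ`, with `max X < min Y` when `X` is directly below `Y` and
`max X ≤ min Y` when `X` is directly to the left of `Y`. -/
def IsSVFilling (γ : YoungDiagram) (e : ℕ × ℕ → Finset ℕ) : Prop :=
  (∀ c : ℕ × ℕ, c ∈ γ ↔ (e c).Nonempty) ∧
  (∀ c : ℕ × ℕ, ∀ x ∈ e c, 0 < x) ∧
  (∀ r c : ℕ, ∀ x ∈ e (r, c), ∀ y ∈ e (r + 1, c), x < y) ∧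
  (∀ r c : ℕ, ∀ x ∈ e (r, c), ∀ y ∈ e (r, c + 1), x ≤ y)

/-- The set of cells of `T_{≤ x}`: cells containing a letter `≤ x`. -/
noncomputable def shapeLe (γ : YoungDiagram) (e : ℕ × ℕ → Finset ℕ) (x : ℕ) : Finset (ℕ × ℕ) :=
  γ.cells.filter fun c => ∃ y ∈ e c, y ≤ x

/-- A standard affine set-valued tableau of degree `n` and shape `γ`: a set-valued filling with
letters `1, …, n` such that for each `x`, the shape of `T_{≤x}` is a `(k+1)`-core and the letter
`x` occupies exactly all of its removable corners of one single residue. -/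
def IsStdASVT (k n : ℕ) (γ : YoungDiagram) (e : ℕ × ℕ → Finset ℕ) : Prop :=
  IsSVFilling γ e ∧
  (∀ c : ℕ × ℕ, ∀ y ∈ e c, y ≤ n) ∧
  ∀ x : ℕ, 1 ≤ x → x ≤ n →
    ∃ δ : YoungDiagram, IsCore (k + 1) δ ∧ δ.cells = shapeLe γ e x ∧
      ∃ i : ZMod (k + 1), (∃ c, x ∈ e c) ∧
        ∀ c : ℕ × ℕ, x ∈ e c ↔ Removable δ c ∧ residue k c = i

/-- The alphabet `𝒜_{α,x} = {Σ^{x-1}α + 1, …, Σ^x α}`. -/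
def alphaBlock (α : List ℕ) (x : ℕ) : Finset ℕ :=
  Finset.Ioc ((α.take (x - 1)).sum) ((α.take x).sum)

/-- `c` is the lowest occurrence of the letter `y`. -/
def IsLowestOcc (e : ℕ × ℕ → Finset ℕ) (y : ℕ) (c : ℕ × ℕ) : Prop :=
  y ∈ e c ∧ ∀ d : ℕ × ℕ, y ∈ e d → c.1 ≤ d.1

/-- `a` comes strictly before `b` in the reading order (top to bottom, left to right;
higher rows of the Ferrers shape have larger first coordinate here). -/
def ReadBefore (a b : ℕ × ℕ) : Prop :=
  b.1 < a.1 ∨ (a.1 = b.1 ∧ a.2 < b.2)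

/-- An affine set-valued tableau of weight `α` and shape `γ`: a standard affine set-valued
tableau of degree `|α|` such that for each `x`, the lowest reading word in `𝒜_{α,x}` is
increasing, the letters of `𝒜_{α,x}` occupy exactly `α_x` distinct residues, and they form a
horizontal strip. -/
def IsASVT (k : ℕ) (α : List ℕ) (γ : YoungDiagram) (e : ℕ × ℕ → Finset ℕ) : Prop :=
  IsStdASVT k α.sum γ e ∧
  ∀ x : ℕ, 1 ≤ x → x ≤ α.length →
    (∀ y z : ℕ, y ∈ alphaBlock α x → z ∈ alphaBlock α x → y < z →
      ∀ cy cz : ℕ × ℕ, IsLowestOcc e y cy → IsLowestOcc e z cz → ReadBefore cy cz) ∧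
    (((γ.cells.filter fun c => ∃ y ∈ alphaBlock α x, y ∈ e c).image (residue k)).card
        = α.getD (x - 1) 0) ∧
    (∀ c d : ℕ × ℕ, (∃ y ∈ alphaBlock α x, y ∈ e c) → (∃ y ∈ alphaBlock α x, y ∈ e d) →
      c.2 = d.2 → c = d)

/-- `𝒦^{(k)}_{λα}`: the number of affine set-valued tableaux of shape `𝔠(λ)` and weight `α`. -/
noncomputable def Kcal (k : ℕ) (lam : YoungDiagram) (α : List ℕ) : ℕ :=
  Nat.card {e : ℕ × ℕ → Finset ℕ // IsASVT k α (coreOf k lam) e}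

/-- A `k`-tableau of shape `γ` and weight `α`: a semistandard filling with letters `1,…,ℓ(α)`
(recorded as `0` outside `γ`) in which the letter `i` occupies exactly `α_i` distinct residues. -/
def IsKTab (k : ℕ) (α : List ℕ) (γ : YoungDiagram) (u : ℕ × ℕ → ℕ) : Prop :=
  (∀ c : ℕ × ℕ, c ∈ γ ↔ u c ≠ 0) ∧
  (∀ c : ℕ × ℕ, u c ≤ α.length) ∧
  (∀ r c : ℕ, (r, c) ∈ γ → (r + 1, c) ∈ γ → u (r, c) < u (r + 1, c)) ∧
  (∀ r c : ℕ, (r, c) ∈ γ → (r, c + 1) ∈ γ → u (r, c) ≤ u (r, c + 1)) ∧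
  ∀ i : ℕ, 1 ≤ i → i ≤ α.length →
    ((γ.cells.filter fun c => u c = i).image (residue k)).card = α.getD (i - 1) 0

/-- `K^{(k)}_{λα}`: the number of `k`-tableaux of shape `𝔠(λ)` and weight `α`. -/
noncomputable def Kktab (k : ℕ) (lam : YoungDiagram) (α : List ℕ) : ℕ :=
  Nat.card {u : ℕ × ℕ → ℕ // IsKTab k α (coreOf k lam) u}

/-- A plain set-valued tableau of shape `λ` and weight `α`. -/
def IsSVT (α : List ℕ) (lam : YoungDiagram) (e : ℕ × ℕ → Finset ℕ) : Prop :=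
  IsSVFilling lam e ∧ (∀ c : ℕ × ℕ, ∀ x ∈ e c, x ≤ α.length) ∧
  ∀ i : ℕ, 1 ≤ i → i ≤ α.length →
    (lam.cells.filter fun c => i ∈ e c).card = α.getD (i - 1) 0

/-- `𝒦_{λα}`: the number of set-valued tableaux of shape `λ` and weight `α`. -/
noncomputable def KcalSV (lam : YoungDiagram) (α : List ℕ) : ℕ :=
  Nat.card {e : ℕ × ℕ → Finset ℕ // IsSVT α lam e}


/-! ## The ring of symmetric functions, realized as `Λ ≅ ℤ[h₁, h₂, …]`,
the free polynomial ring on the complete homogeneous symmetric functions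
(variable `n` is `h_{n+1}`). -/

abbrev SymFunc := MvPolynomial ℕ ℤ

/-- The complete homogeneous symmetric function `h_r` (`h_0 = 1`). -/
noncomputable def hSym : ℕ → SymFunc
  | 0 => 1
  | n + 1 => MvPolynomial.X n

/-- The elementary symmetric function
`e_n = Σ_{α ⊨ n} (-1)^{n - ℓ(α)} h_α` (sum over compositions of `n`). -/
noncomputable def eSym (n : ℕ) : SymFunc :=
  ∑ c : Composition n, (-1 : SymFunc) ^ (n - c.length) * (c.blocks.map hSym).prod

/-- `h_λ = h_{λ_1} ⋯ h_{λ_ℓ}` for a partition `λ`. -/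
noncomputable def hProd (lam : YoungDiagram) : SymFunc :=
  (lam.rowLens.map hSym).prod

/-- `Λ^{(k)} = ℤ[h_1, …, h_k]` as a subalgebra of `Λ`. -/
noncomputable def LambdaK (k : ℕ) : Subalgebra ℤ SymFunc :=
  MvPolynomial.supported ℤ {n : ℕ | n < k}

/-- The exponent vector of the monomial `h_λ` in the `h`-presentation of `Λ`. -/
noncomputable def hExp (lam : YoungDiagram) : ℕ →₀ ℕ :=
  Multiset.toFinsupp ((lam.rowLens : Multiset ℕ).map fun r => r - 1)

/-- The coefficient of `h_λ` in the expansion of `p ∈ Λ` in the basis `{h_λ}`. -/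
noncomputable def hCoeff (p : SymFunc) (lam : YoungDiagram) : ℤ :=
  MvPolynomial.coeff (hExp lam) p

/-- The Hall inner product `⟨p, F⟩` of `p ∈ Λ` with a (degree-wise finite) formal series
`F = Σ_ν F(ν) m_ν` in the monomial symmetric functions, characterized by
`⟨h_λ, m_μ⟩ = δ_{λμ}`. -/
noncomputable def hallPair (p : SymFunc) (F : YoungDiagram → ℤ) : ℤ :=
  ∑ᶠ ν : YoungDiagram, hCoeff p ν * F ν

/-- The column dual Grothendieck polynomial `g_{1^m} = Σ_{j=1}^m binom(m-1, j-1) e_j`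
(`g_{1^0} = 1`). -/
noncomputable def gColumn (m : ℕ) : SymFunc :=
  if m = 0 then 1 else ∑ j ∈ Finset.Icc 1 m, (((m - 1).choose (j - 1) : ℤ)) • eSym j

/-- The algebra endomorphism `Ω` of `Λ` with `Ω(h_ℓ) = Σ_{j=1}^ℓ binom(ℓ-1, j-1) e_j`. -/
noncomputable def OmegaMap : SymFunc →ₐ[ℤ] SymFunc :=
  MvPolynomial.aeval fun n => gColumn (n + 1)

/-- Generalized binomial coefficient `C(n, j)` for an arbitrary integer `n`. -/
def genBinom (n : ℤ) (j : ℕ) : ℤ :=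
  if 0 ≤ n then (n.toNat.choose j : ℤ) else (-1) ^ j * ((j + (-n - 1).toNat).choose j : ℤ)



/-! ## The defining systems for (k-K-)Schur-type bases -/

/-- `g` is the family of `k`-`K`-Schur functions: the unique elements of `Λ^{(k)}` with
`h_λ = Σ_{μ ∈ 𝒫^k, |μ| ≤ |λ|} (-1)^{|λ|+|μ|} 𝒦^{(k)}_{μλ} g^{(k)}_μ` for all `λ ∈ 𝒫^k`. -/
def KKSchurSystem (k : ℕ) (g : YoungDiagram → SymFunc) : Prop :=
  (∀ lam : YoungDiagram, IsKBounded k lam → g lam ∈ LambdaK k) ∧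
  ∀ lam : YoungDiagram, IsKBounded k lam →
    hProd lam = ∑ᶠ μ : YoungDiagram,
      if IsKBounded k μ ∧ μ.card ≤ lam.card then
        ((-1 : ℤ) ^ (lam.card + μ.card) * (Kcal k μ lam.rowLens : ℤ)) • g μ
      else 0

/-- `gd` is the family of dual Grothendieck polynomials: determined by
`h_μ = Σ_{|λ| ≤ |μ|} (-1)^{|λ|+|μ|} 𝒦_{λμ} g_λ` for all partitions `μ`. -/
def DualGrothSystem (gd : YoungDiagram → SymFunc) : Prop :=
  ∀ mu : YoungDiagram,
    hProd mu = ∑ᶠ lam : YoungDiagram,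
      if lam.card ≤ mu.card then
        ((-1 : ℤ) ^ (lam.card + mu.card) * (KcalSV lam mu.rowLens : ℤ)) • gd lam
      else 0

/-- `s` is the family of `k`-Schur functions: the unique elements of `Λ^{(k)}` with
`h_λ = s^{(k)}_λ + Σ_{μ ⊳ λ} K^{(k)}_{μλ} s^{(k)}_μ` for all `λ ∈ 𝒫^k`. -/
def KSchurSystem (k : ℕ) (s : YoungDiagram → SymFunc) : Prop :=
  (∀ lam : YoungDiagram, IsKBounded k lam → s lam ∈ LambdaK k) ∧
  ∀ lam : YoungDiagram, IsKBounded k lam →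
    hProd lam = s lam + ∑ᶠ μ : YoungDiagram,
      if IsKBounded k μ ∧ Dominates μ lam ∧ μ ≠ lam then
        (Kktab k μ lam.rowLens : ℤ) • s μ
      else 0


/-! ## Hooks in small diagrams -/

/-- The cells of the hook of `(r, c)` in `γ`, other than `(r, c)` itself. -/
noncomputable def hookTail (γ : YoungDiagram) (r c : ℕ) : Finset (ℕ × ℕ) :=
  (Finset.Ioo c (γ.rowLen r)).image (fun j => (r, j)) ∪
    (Finset.Ioo r (γ.colLen c)).image (fun i => (i, c))

lemma card_hookTail {γ : YoungDiagram} {r c : ℕ} (h : (r, c) ∈ γ) :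
    (hookTail γ r c).card + 1 = hookLen γ r c := by
  have h1 := YoungDiagram.mem_iff_lt_rowLen.1 h
  have h2 := YoungDiagram.mem_iff_lt_colLen.1 h
  rw [hookTail, Finset.card_union_of_disjoint, Finset.card_image_of_injective,
    Finset.card_image_of_injective, Nat.card_Ioo, Nat.card_Ioo, hookLen]
  · omega
  · intro a b; simp
  · intro a b; simp
  · rw [Finset.disjoint_left]
    simp only [Finset.mem_image, Finset.mem_Ioo]
    rintro _ ⟨a, ha, rfl⟩ ⟨b, hb, hab⟩
    simp only [Prod.mk.injEq] at hab
    omega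

lemma mem_of_mem_hookTail {γ : YoungDiagram} {r c : ℕ} {d : ℕ × ℕ} (hd : d ∈ hookTail γ r c) :
    d ∈ γ ∧ (r, c) < d := by
  simp only [hookTail, Finset.mem_union, Finset.mem_image, Finset.mem_Ioo] at hd
  rcases hd with ⟨j, hj, rfl⟩ | ⟨i, hi, rfl⟩
  · exact ⟨YoungDiagram.mem_iff_lt_rowLen.2 hj.2, Prod.mk_lt_mk.2 (Or.inr ⟨le_rfl, hj.1⟩)⟩
  · exact ⟨YoungDiagram.mem_iff_lt_colLen.2 hi.2, Prod.mk_lt_mk.2 (Or.inl ⟨hi.1, le_rfl⟩)⟩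

lemma hookLen_le_card {γ : YoungDiagram} {r c : ℕ} (h : (r, c) ∈ γ) :
    hookLen γ r c ≤ γ.card := by
  have hn : (r, c) ∉ hookTail γ r c := fun h' => (mem_of_mem_hookTail h').2.ne rfl
  rw [← card_hookTail h, ← Finset.card_insert_of_notMem hn]
  refine Finset.card_le_card fun d hd => ?_
  rcases Finset.mem_insert.1 hd with rfl | hd
  · exact h
  · exact (mem_of_mem_hookTail hd).1

lemma isCore_of_card_le {k : ℕ} {γ : YoungDiagram} (h : γ.card ≤ k) : IsCore (k + 1) γ := by
  intro c hc
  have := hookLen_le_card (γ := γ) (r := c.1) (c := c.2) hc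
  omega

lemma pRow_eq_rowLen {k : ℕ} {γ : YoungDiagram} (h : ∀ c ∈ γ, hookLen γ c.1 c.2 ≤ k) (i : ℕ) :
    pRow k γ i = γ.rowLen i := by
  rw [pRow, YoungDiagram.rowLen_eq_card, YoungDiagram.row]
  congr 1
  ext c
  simp only [Finset.mem_filter, YoungDiagram.mem_cells]
  exact ⟨fun hc => ⟨hc.1, hc.2.1⟩, fun hc => ⟨hc.1, hc.2, h c hc.1⟩⟩

lemma eq_of_rowLen_eq {γ μ : YoungDiagram} (h : ∀ i, γ.rowLen i = μ.rowLen i) : γ = μ := by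
  ext ⟨i, j⟩
  simp only [YoungDiagram.mem_cells, YoungDiagram.mem_iff_lt_rowLen, h]

lemma pSize_eq_card {k : ℕ} {γ μ : YoungDiagram} (h : ∀ i, pRow k γ i = μ.rowLen i) :
    pSize k γ = μ.card := by
  obtain ⟨N, hN⟩ : ∃ N, ∀ c ∈ γ.cells ∪ μ.cells, c.1 < N :=
    ⟨(γ.cells ∪ μ.cells).sup Prod.fst + 1, fun c hc => Nat.lt_succ_of_le (Finset.le_sup hc)⟩
  rw [pSize, YoungDiagram.card,
    Finset.card_eq_sum_card_fiberwise (f := Prod.fst) (t := Finset.range N),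
    Finset.card_eq_sum_card_fiberwise (s := μ.cells) (f := Prod.fst) (t := Finset.range N)]
  · refine Finset.sum_congr rfl fun i _ => ?_
    have hi := h i
    rw [YoungDiagram.rowLen_eq_card, YoungDiagram.row, pRow] at hi
    rw [← hi, Finset.filter_filter]
    simp only [and_comm]
  · intro c hc
    exact Finset.mem_coe.2 (Finset.mem_range.2 (hN c (Finset.mem_union_right _ hc)))
  · intro c hc
    exact Finset.mem_coe.2 (Finset.mem_range.2
      (hN c (Finset.mem_union_left _ (Finset.mem_filter.1 hc).1)))

/-- A core with few cells of bounded hook length has only cells of bounded hook length. -/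
lemma IsCore.hookLen_le {k : ℕ} {γ : YoungDiagram} (hγ : IsCore (k + 1) γ) (hs : pSize k γ ≤ k) :
    ∀ c ∈ γ, hookLen γ c.1 c.2 ≤ k := by
  by_contra! hex
  obtain ⟨c₀, hc₀, hk₀⟩ := hex
  obtain ⟨⟨r, c⟩, hm, hmax⟩ := Finset.exists_maximal (s := γ.cells.filter
    fun c => k < hookLen γ c.1 c.2) ⟨c₀, Finset.mem_filter.2 ⟨hc₀, hk₀⟩⟩
  obtain ⟨hc, hk⟩ := Finset.mem_filter.1 hm
  have hsub : hookTail γ r c ⊆ γ.cells.filter fun c => hookLen γ c.1 c.2 ≤ k := by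
    intro d hd
    obtain ⟨hdγ, hlt⟩ := mem_of_mem_hookTail hd
    refine Finset.mem_filter.2 ⟨hdγ, ?_⟩
    by_contra! hdk
    exact hlt.not_ge (hmax (Finset.mem_filter.2 ⟨hdγ, hdk⟩) hlt.le)
  have h1 := Finset.card_le_card hsub
  have h2 := card_hookTail hc
  have h3 := hγ _ hc
  simp only [pSize] at hs
  simp only at hk h3
  omega

lemma coreOf_eq_self {k : ℕ} {μ : YoungDiagram} (h : μ.card ≤ k) : coreOf k μ = μ := by
  have hex : ∃ γ, IsCore (k + 1) γ ∧ ∀ i, pRow k γ i = μ.rowLen i :=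
    ⟨μ, isCore_of_card_le h, pRow_eq_rowLen fun c hc => (hookLen_le_card hc).trans h⟩
  obtain ⟨h1, h2⟩ := Classical.epsilon_spec hex
  refine eq_of_rowLen_eq fun i => ?_
  rw [coreOf, ← h2 i, pRow_eq_rowLen (h1.hookLen_le ((pSize_eq_card h2).trans_le h))]

lemma add_lt_card {γ : YoungDiagram} {c d : ℕ × ℕ} (hc : c ∈ γ) (hd : d ∈ γ) :
    c.1 + d.2 < γ.card := by
  have h1 : (c.1, 0) ∈ γ := γ.up_left_mem le_rfl (Nat.zero_le _) hc
  have h2 : (0, d.2) ∈ γ := γ.up_left_mem (Nat.zero_le _) le_rfl hd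
  have h3 := hookLen_le_card (γ.up_left_mem (Nat.zero_le _) le_rfl h1)
  have h4 := YoungDiagram.mem_iff_lt_rowLen.1 h2
  have h5 := YoungDiagram.mem_iff_lt_colLen.1 h1
  rw [hookLen] at h3
  omega

lemma content_eq_of_residue_eq {k : ℕ} {γ : YoungDiagram} (h : γ.card ≤ k) {c d : ℕ × ℕ}
    (hc : c ∈ γ) (hd : d ∈ γ) (hr : residue k c = residue k d) : c.2 + d.1 = d.2 + c.1 := by
  have h1 := add_lt_card hc hd
  have h2 := add_lt_card hd hc
  have h3 : ((c.2 + d.1 : ℕ) : ZMod (k + 1)) = ((d.2 + c.1 : ℕ) : ZMod (k + 1)) := by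
    rw [residue, residue, sub_eq_sub_iff_add_eq_add] at hr
    exact_mod_cast hr
  rw [ZMod.natCast_eq_natCast_iff] at h3
  exact Nat.ModEq.eq_of_lt_of_lt h3 (by omega) (by omega)

/-! ## Set-valued fillings and reading order -/

lemma IsSVFilling.lt_of_col {γ : YoungDiagram} {e : ℕ × ℕ → Finset ℕ} (h : IsSVFilling γ e)
    {r s c x y : ℕ} (hrs : r < s) (hx : x ∈ e (r, c)) (hy : y ∈ e (s, c)) : x < y := by
  induction s, hrs using Nat.le_induction generalizing y with
  | base => exact h.2.2.1 _ _ _ hx _ hy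
  | succ s hs ih =>
    have hγ : (s, c) ∈ γ := γ.up_left_mem s.le_succ le_rfl ((h.1 _).2 ⟨y, hy⟩)
    obtain ⟨z, hz⟩ := (h.1 _).1 hγ
    exact (ih hz).trans (h.2.2.1 _ _ _ hz _ hy)

lemma IsSVFilling.le_of_row {γ : YoungDiagram} {e : ℕ × ℕ → Finset ℕ} (h : IsSVFilling γ e)
    {r c d x y : ℕ} (hcd : c < d) (hx : x ∈ e (r, c)) (hy : y ∈ e (r, d)) : x ≤ y := by
  induction d, hcd using Nat.le_induction generalizing y with
  | base => exact h.2.2.2 _ _ _ hx _ hy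
  | succ d hd ih =>
    have hγ : (r, d) ∈ γ := γ.up_left_mem le_rfl d.le_succ ((h.1 _).2 ⟨y, hy⟩)
    obtain ⟨z, hz⟩ := (h.1 _).1 hγ
    exact (ih hz).trans (h.2.2.2 _ _ _ hz _ hy)

lemma IsSVFilling.le_of_lt {γ : YoungDiagram} {e : ℕ × ℕ → Finset ℕ} (h : IsSVFilling γ e)
    {c d : ℕ × ℕ} {x y : ℕ} (hcd : c < d) (hx : x ∈ e c) (hy : y ∈ e d) : x ≤ y := by
  obtain ⟨r, c⟩ := c
  obtain ⟨s, d⟩ := d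
  have hle : r ≤ s ∧ c ≤ d := hcd.le
  rcases hle.1.eq_or_lt with rfl | hrs
  · refine h.le_of_row (hle.2.lt_of_ne ?_) hx hy
    rintro rfl
    exact hcd.ne rfl
  · rcases hle.2.eq_or_lt with rfl | hlt
    · exact (h.lt_of_col hrs hx hy).le
    · have hγ : (s, c) ∈ γ := γ.up_left_mem le_rfl hle.2 ((h.1 _).2 ⟨y, hy⟩)
      obtain ⟨z, hz⟩ := (h.1 _).1 hγ
      exact (h.lt_of_col hrs hx hz).le.trans (h.le_of_row hlt hz hy)

lemma readBefore_irrefl (c : ℕ × ℕ) : ¬ ReadBefore c c := by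
  simp [ReadBefore]

lemma ReadBefore.trans {a b c : ℕ × ℕ} (h₁ : ReadBefore a b) (h₂ : ReadBefore b c) :
    ReadBefore a c := by
  simp only [ReadBefore] at *
  omega

lemma readBefore_or_of_ne {c d : ℕ × ℕ} (h : c ≠ d) : ReadBefore c d ∨ ReadBefore d c := by
  simp only [ReadBefore]
  rw [Ne, Prod.ext_iff] at h
  omega

/-! ## Standard affine set-valued tableaux of small shape -/

lemma removable_eq_of_residue_eq {k : ℕ} {γ : YoungDiagram} (h : γ.card ≤ k) {c d : ℕ × ℕ}
    (hc : Removable γ c) (hd : Removable γ d) (hr : residue k c = residue k d) : c = d := by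
  have h1 := content_eq_of_residue_eq h hc.1 hd.1 hr
  rcases lt_trichotomy c.1 d.1 with hlt | heq | hlt
  · exact absurd (γ.up_left_mem hlt (by omega) hd.1) hc.2.1
  · exact Prod.ext heq (by omega)
  · exact absurd (γ.up_left_mem hlt (by omega) hc.1) hd.2.1

lemma isStdASVT_iff {k n : ℕ} {γ : YoungDiagram} {e : ℕ × ℕ → Finset ℕ} (hγ : γ.card ≤ k) :
    IsStdASVT k n γ e ↔ IsSVFilling γ e ∧ (∀ c : ℕ × ℕ, ∀ y ∈ e c, y ≤ n) ∧
      ∀ x : ℕ, 1 ≤ x → x ≤ n → ∃! c, x ∈ e c := by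
  refine and_congr_right fun hf => and_congr_right fun _ => forall₃_congr fun x hx hxn => ?_
  have hcard : ∀ δ : YoungDiagram, δ.cells = shapeLe γ e x → δ.card ≤ k := fun δ hδ =>
    (Finset.card_le_card (hδ ▸ Finset.filter_subset _ _)).trans hγ
  constructor
  · rintro ⟨δ, -, hδ, i, ⟨c, hc⟩, hiff⟩
    refine ⟨c, hc, fun d hd => ?_⟩
    obtain ⟨h1, h2⟩ := (hiff c).1 hc
    obtain ⟨h3, h4⟩ := (hiff d).1 hd
    exact removable_eq_of_residue_eq (hcard δ hδ) h3 h1 (h4.trans h2.symm)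
  · rintro ⟨c, hc, huniq⟩
    let δ : YoungDiagram :=
      { cells := shapeLe γ e x
        isLowerSet := by
          intro a b hba ha
          obtain ⟨haγ, y, hy, hyx⟩ := Finset.mem_filter.1 ha
          have hbγ : b ∈ γ := γ.isLowerSet hba haγ
          obtain ⟨z, hz⟩ := (hf.1 b).1 hbγ
          refine Finset.mem_coe.2 (Finset.mem_filter.2 ⟨hbγ, ?_⟩)
          rcases hba.eq_or_lt with rfl | hlt
          · exact ⟨y, hy, hyx⟩
          · exact ⟨z, hz, (hf.le_of_lt hlt hz hy).trans hyx⟩ }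
    have hmem : ∀ d, d ∈ δ → ∃ y ∈ e d, y ≤ x := fun d hd => (Finset.mem_filter.1 hd).2
    have hrem : Removable δ c := by
      refine ⟨Finset.mem_filter.2 ⟨(hf.1 c).2 ⟨x, hc⟩, x, hc, le_rfl⟩, fun h => ?_, fun h => ?_⟩
      · obtain ⟨y, hy, hyx⟩ := hmem _ h
        exact (hf.2.2.1 _ _ x hc y hy).not_ge hyx
      · obtain ⟨y, hy, hyx⟩ := hmem _ h
        obtain rfl := hyx.antisymm (hf.2.2.2 _ _ x hc y hy)
        have := congrArg Prod.snd (huniq _ hy)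
        simp at this
    refine ⟨δ, isCore_of_card_le (hcard δ rfl), rfl, residue k c, ⟨c, hc⟩, fun d => ?_⟩
    constructor
    · intro hd
      obtain rfl := huniq d hd
      exact ⟨hrem, rfl⟩
    · rintro ⟨h1, h2⟩
      rwa [removable_eq_of_residue_eq (hcard δ rfl) h1 hrem h2]

/-! ## Alphabets -/

lemma mem_alphaBlock {α : List ℕ} {i y : ℕ} :
    y ∈ alphaBlock α i ↔ (α.take (i - 1)).sum < y ∧ y ≤ (α.take i).sum :=
  Finset.mem_Ioc

lemma sum_take_succ_eq (α : List ℕ) (i : ℕ) :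
    (α.take (i + 1)).sum = (α.take i).sum + α.getD i 0 := by
  rcases lt_or_ge i α.length with h | h
  · rw [List.sum_take_succ _ _ h, List.getD_eq_getElem _ _ h]
  · rw [List.take_of_length_le h, List.take_of_length_le (h.trans i.le_succ),
      List.getD_eq_default _ _ h, add_zero]

lemma sum_take_mono (α : List ℕ) : Monotone fun i => (α.take i).sum :=
  monotone_nat_of_le_succ fun i => by rw [sum_take_succ_eq]; exact Nat.le_add_right _ _

lemma sum_take_le_sum (α : List ℕ) (i : ℕ) : (α.take i).sum ≤ α.sum := by
  conv_rhs => rw [← List.sum_take_add_sum_drop α i]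
  exact Nat.le_add_right _ _

lemma card_alphaBlock {α : List ℕ} {i : ℕ} (hi : 1 ≤ i) :
    (alphaBlock α i).card = α.getD (i - 1) 0 := by
  obtain ⟨i, rfl⟩ := Nat.exists_eq_add_of_le' hi
  rw [alphaBlock, Nat.card_Ioc, Nat.add_sub_cancel, sum_take_succ_eq, Nat.add_sub_cancel_left]

lemma exists_mem_alphaBlock {α : List ℕ} {y : ℕ} (h0 : 0 < y) (hy : y ≤ α.sum) :
    ∃ i, 1 ≤ i ∧ i ≤ α.length ∧ y ∈ alphaBlock α i := by
  have hex : ∃ i, y ≤ (α.take i).sum := ⟨α.length, by simpa using hy⟩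
  have hpos : Nat.find hex ≠ 0 := by
    intro h
    have := Nat.find_spec hex
    rw [h] at this
    simp at this
    omega
  refine ⟨Nat.find hex, Nat.pos_of_ne_zero hpos, Nat.find_min' hex (by simpa using hy),
    mem_alphaBlock.2 ⟨?_, Nat.find_spec hex⟩⟩
  exact not_le.1 (Nat.find_min hex (Nat.sub_lt (Nat.pos_of_ne_zero hpos) one_pos))

lemma lt_of_mem_alphaBlock_of_lt {α : List ℕ} {i j y z : ℕ} (hij : i < j)
    (hy : y ∈ alphaBlock α i) (hz : z ∈ alphaBlock α j) : y < z :=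
  ((mem_alphaBlock.1 hy).2.trans (sum_take_mono α (Nat.le_sub_one_of_lt hij))).trans_lt
    (mem_alphaBlock.1 hz).1

lemma eq_of_mem_alphaBlock {α : List ℕ} {i j y : ℕ} (hi : y ∈ alphaBlock α i)
    (hj : y ∈ alphaBlock α j) : i = j := by
  rcases lt_trichotomy i j with h | h | h
  · exact absurd (lt_of_mem_alphaBlock_of_lt h hi hj) (lt_irrefl _)
  · exact h
  · exact absurd (lt_of_mem_alphaBlock_of_lt h hj hi) (lt_irrefl _)

lemma mem_Icc_of_mem_alphaBlock {α : List ℕ} {i y : ℕ} (hy : y ∈ alphaBlock α i) :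
    1 ≤ y ∧ y ≤ α.sum :=
  ⟨Nat.one_le_of_lt (mem_alphaBlock.1 hy).1, (mem_alphaBlock.1 hy).2.trans (sum_take_le_sum α i)⟩

/-! ## Standardization -/

/-- A standardized set-valued tableau of weight `α`: each of the letters `1, …, |α|` occurs exactly
once, and the letters of each alphabet of `α` form a horizontal strip read increasingly. -/
structure IsStandardized (α : List ℕ) (γ : YoungDiagram) (e : ℕ × ℕ → Finset ℕ) : Prop where
  filling : IsSVFilling γ e
  le_sum : ∀ c : ℕ × ℕ, ∀ y ∈ e c, y ≤ α.sum
  existsUnique_cell : ∀ x : ℕ, 1 ≤ x → x ≤ α.sum → ∃! c, x ∈ e c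
  readBefore : ∀ x : ℕ, 1 ≤ x → x ≤ α.length → ∀ y ∈ alphaBlock α x, ∀ z ∈ alphaBlock α x,
    y < z → ∀ c d : ℕ × ℕ, y ∈ e c → z ∈ e d → ReadBefore c d
  strip : ∀ x : ℕ, 1 ≤ x → x ≤ α.length → ∀ c d : ℕ × ℕ, (∃ y ∈ alphaBlock α x, y ∈ e c) →
    (∃ y ∈ alphaBlock α x, y ∈ e d) → c.2 = d.2 → c = d

namespace IsStandardized

variable {α : List ℕ} {γ : YoungDiagram} {e : ℕ × ℕ → Finset ℕ}

lemma exists_cell (h : IsStandardized α γ e) : ∃ cell : ℕ → ℕ × ℕ, ∀ i, ∀ x ∈ alphaBlock α i,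
    x ∈ e (cell x) ∧ ∀ c, x ∈ e c → c = cell x := by
  choose! cell hcell using h.existsUnique_cell
  refine ⟨cell, fun i x hx => ?_⟩
  obtain ⟨h1, h2⟩ := mem_Icc_of_mem_alphaBlock hx
  exact hcell x h1 h2

lemma eq_of_mem_cell (h : IsStandardized α γ e) {x y z : ℕ} {c : ℕ × ℕ} (hx : 1 ≤ x)
    (hxl : x ≤ α.length) (hy : y ∈ alphaBlock α x) (hz : z ∈ alphaBlock α x) (hyc : y ∈ e c)
    (hzc : z ∈ e c) : y = z := by
  rcases lt_trichotomy y z with hlt | heq | hlt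
  · exact absurd (h.readBefore x hx hxl y hy z hz hlt c c hyc hzc) (readBefore_irrefl c)
  · exact heq
  · exact absurd (h.readBefore x hx hxl z hz y hy hlt c c hzc hyc) (readBefore_irrefl c)

lemma card_cells (h : IsStandardized α γ e) {x : ℕ} (hx : 1 ≤ x) (hxl : x ≤ α.length) :
    (γ.cells.filter fun c => ∃ y ∈ alphaBlock α x, y ∈ e c).card = α.getD (x - 1) 0 := by
  obtain ⟨cell, hcell⟩ := h.exists_cell
  rw [← card_alphaBlock hx]
  symm
  refine Finset.card_bij (fun y _ => cell y) ?_ ?_ ?_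
  · intro y hy
    have := (hcell x y hy).1
    exact Finset.mem_filter.2 ⟨(h.filling.1 _).2 ⟨y, this⟩, y, hy, this⟩
  · intro y hy z hz hyz
    exact h.eq_of_mem_cell hx hxl hy hz (hcell x y hy).1 (hyz ▸ (hcell x z hz).1)
  · intro c hc
    obtain ⟨-, y, hy, hyc⟩ := Finset.mem_filter.1 hc
    exact ⟨y, hy, ((hcell x y hy).2 c hyc).symm⟩

lemma eq_of_content_eq (h : IsStandardized α γ e) {x : ℕ} (hx : 1 ≤ x) (hxl : x ≤ α.length)
    {c d : ℕ × ℕ} (hc : ∃ y ∈ alphaBlock α x, y ∈ e c) (hd : ∃ y ∈ alphaBlock α x, y ∈ e d)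
    (hcd : c.2 + d.1 = d.2 + c.1) : c = d := by
  wlog hle : c.1 ≤ d.1 generalizing c d
  · exact (this hd hc hcd.symm (by omega)).symm
  rcases hle.eq_or_lt with heq | hlt
  · exact Prod.ext heq (by omega)
  obtain ⟨y, hy, hyc⟩ := hc
  obtain ⟨w, hw, hwd⟩ := hd
  have hγ : (d.1, c.2) ∈ γ :=
    γ.up_left_mem (j2 := d.2) le_rfl (by omega) ((h.filling.1 _).2 ⟨w, hwd⟩)
  obtain ⟨z, hz⟩ := (h.filling.1 _).1 hγ
  have h1 : y < z := h.filling.lt_of_col hlt hyc hz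
  have h2 : z ≤ w := h.filling.le_of_row (d := d.2) (by omega) hz hwd
  have hzx : z ∈ alphaBlock α x :=
    mem_alphaBlock.2 ⟨(mem_alphaBlock.1 hy).1.trans h1, h2.trans (mem_alphaBlock.1 hw).2⟩
  have := congrArg Prod.fst (h.strip x hx hxl c (d.1, c.2) ⟨y, hy, hyc⟩ ⟨z, hzx, hz⟩ rfl)
  simp only at this
  omega

end IsStandardized

lemma isASVT_iff_isStandardized {k : ℕ} {α : List ℕ} {γ : YoungDiagram} {e : ℕ × ℕ → Finset ℕ}
    (hγ : γ.card ≤ k) : IsASVT k α γ e ↔ IsStandardized α γ e := by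
  rw [IsASVT, isStdASVT_iff hγ]
  constructor
  · rintro ⟨⟨h1, h2, h3⟩, h4⟩
    have hlow : ∀ {x : ℕ}, ∀ y ∈ alphaBlock α x, ∀ c, y ∈ e c → IsLowestOcc e y c := by
      intro x y hy c hc
      obtain ⟨h5, h6⟩ := mem_Icc_of_mem_alphaBlock hy
      exact ⟨hc, fun d hd => ((h3 y h5 h6).unique hc hd ▸ le_rfl)⟩
    exact ⟨h1, h2, h3, fun x hx hxl y hy z hz hyz c d hc hd =>
      (h4 x hx hxl).1 y z hy hz hyz c d (hlow y hy c hc) (hlow z hz d hd),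
      fun x hx hxl => (h4 x hx hxl).2.2⟩
  · intro h
    refine ⟨⟨h.filling, h.le_sum, h.existsUnique_cell⟩, fun x hx hxl => ⟨?_, ?_, h.strip x hx hxl⟩⟩
    · exact fun y z hy hz hyz c d hc hd => h.readBefore x hx hxl y hy z hz hyz c d hc.1 hd.1
    · rw [Finset.card_image_of_injOn, h.card_cells hx hxl]
      intro c hc d hd hcd
      obtain ⟨hcγ, hc⟩ := Finset.mem_filter.1 hc
      obtain ⟨hdγ, hd⟩ := Finset.mem_filter.1 hd
      exact h.eq_of_content_eq hx hxl hc hd (content_eq_of_residue_eq hγ hcγ hdγ hcd)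

/-- The filling obtained by replacing each letter of the `i`-th alphabet of `α` by `i`. -/
noncomputable def destandardize (α : List ℕ) (e : ℕ × ℕ → Finset ℕ) (c : ℕ × ℕ) : Finset ℕ :=
  (Finset.Icc 1 α.length).filter fun i => ∃ y ∈ alphaBlock α i, y ∈ e c

/-- The number of cells of `γ` containing `i` that are read before `c`. -/
noncomputable def readRank (γ : YoungDiagram) (u : ℕ × ℕ → Finset ℕ) (i : ℕ) (c : ℕ × ℕ) : ℕ :=
  (γ.cells.filter fun d => i ∈ u d ∧ ReadBefore d c).card

/-- The filling obtained by replacing the letters `i` by the letters of the `i`-th alphabet of `α`,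
in reading order. -/
noncomputable def standardize (α : List ℕ) (γ : YoungDiagram) (u : ℕ × ℕ → Finset ℕ)
    (c : ℕ × ℕ) : Finset ℕ :=
  (u c).image fun i => (α.take (i - 1)).sum + readRank γ u i c + 1

lemma mem_destandardize {α : List ℕ} {e : ℕ × ℕ → Finset ℕ} {c : ℕ × ℕ} {i : ℕ} :
    i ∈ destandardize α e c ↔ (1 ≤ i ∧ i ≤ α.length) ∧ ∃ y ∈ alphaBlock α i, y ∈ e c := by
  rw [destandardize, Finset.mem_filter, Finset.mem_Icc]

lemma mem_standardize {α : List ℕ} {γ : YoungDiagram} {u : ℕ × ℕ → Finset ℕ} {c : ℕ × ℕ}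
    {y : ℕ} : y ∈ standardize α γ u c ↔
      ∃ i ∈ u c, (α.take (i - 1)).sum + readRank γ u i c + 1 = y := by
  rw [standardize, Finset.mem_image]

namespace IsStandardized

variable {α : List ℕ} {γ : YoungDiagram} {e : ℕ × ℕ → Finset ℕ}

lemma isSVT_destandardize (h : IsStandardized α γ e) : IsSVT α γ (destandardize α e) := by
  refine ⟨⟨fun c => ?_, ?_, ?_, ?_⟩, ?_, ?_⟩
  · rw [h.filling.1 c]
    constructor
    · rintro ⟨y, hy⟩
      obtain ⟨i, h1, h2, h3⟩ :=
        exists_mem_alphaBlock (h.filling.2.1 c y hy) (h.le_sum c y hy)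
      exact ⟨i, mem_destandardize.2 ⟨⟨h1, h2⟩, y, h3, hy⟩⟩
    · rintro ⟨i, hi⟩
      obtain ⟨-, y, -, hy⟩ := mem_destandardize.1 hi
      exact ⟨y, hy⟩
  · exact fun c i hi => (mem_destandardize.1 hi).1.1
  · intro r c i hi j hj
    obtain ⟨hi1, y, hyi, hy⟩ := mem_destandardize.1 hi
    obtain ⟨-, z, hzj, hz⟩ := mem_destandardize.1 hj
    have hyz := h.filling.2.2.1 r c y hy z hz
    rcases lt_trichotomy i j with hlt | rfl | hlt
    · exact hlt
    · have := congrArg Prod.fst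
        (h.strip i hi1.1 hi1.2 (r, c) (r + 1, c) ⟨y, hyi, hy⟩ ⟨z, hzj, hz⟩ rfl)
      simp at this
    · exact absurd (lt_of_mem_alphaBlock_of_lt hlt hzj hyi) hyz.not_gt
  · intro r c i hi j hj
    obtain ⟨-, y, hyi, hy⟩ := mem_destandardize.1 hi
    obtain ⟨-, z, hzj, hz⟩ := mem_destandardize.1 hj
    have hyz := h.filling.2.2.2 r c y hy z hz
    by_contra! hlt
    exact hyz.not_gt (lt_of_mem_alphaBlock_of_lt hlt hzj hyi)
  · exact fun c i hi => (mem_destandardize.1 hi).1.2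
  · intro i hi hil
    rw [← h.card_cells hi hil]
    congr 1
    ext c
    simp only [Finset.mem_filter, mem_destandardize, hi, hil, true_and]

lemma readRank_destandardize (h : IsStandardized α γ e) {i y : ℕ} {c : ℕ × ℕ} (hi : 1 ≤ i)
    (hil : i ≤ α.length) (hy : y ∈ alphaBlock α i) (hyc : y ∈ e c) :
    (α.take (i - 1)).sum + readRank γ (destandardize α e) i c + 1 = y := by
  obtain ⟨cell, hcell⟩ := h.exists_cell
  obtain ⟨hy1, hy2⟩ := mem_alphaBlock.1 hy
  have hsub : ∀ z ∈ Finset.Ioo (α.take (i - 1)).sum y, z ∈ alphaBlock α i := fun z hz =>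
    mem_alphaBlock.2 ⟨(Finset.mem_Ioo.1 hz).1, (Finset.mem_Ioo.1 hz).2.le.trans hy2⟩
  have hcard : (Finset.Ioo (α.take (i - 1)).sum y).card =
      readRank γ (destandardize α e) i c := by
    refine Finset.card_bij (fun z _ => cell z) ?_ ?_ ?_
    · intro z hz
      have hzb := hsub z hz
      have hzc := (hcell i z hzb).1
      exact Finset.mem_filter.2 ⟨(h.filling.1 _).2 ⟨z, hzc⟩,
        mem_destandardize.2 ⟨⟨hi, hil⟩, z, hzb, hzc⟩,
        h.readBefore i hi hil z hzb y hy (Finset.mem_Ioo.1 hz).2 _ _ hzc hyc⟩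
    · intro z hz w hw hzw
      exact h.eq_of_mem_cell hi hil (hsub z hz) (hsub w hw) (hcell i z (hsub z hz)).1
        (hzw ▸ (hcell i w (hsub w hw)).1)
    · intro d hd
      obtain ⟨-, hd1, hdc⟩ := Finset.mem_filter.1 hd
      obtain ⟨-, z, hz, hzd⟩ := mem_destandardize.1 hd1
      refine ⟨z, Finset.mem_Ioo.2 ⟨(mem_alphaBlock.1 hz).1, ?_⟩, ((hcell i z hz).2 d hzd).symm⟩
      rcases lt_trichotomy z y with hlt | rfl | hlt
      · exact hlt
      · rw [(hcell i z hz).2 d hzd, (hcell i z hz).2 c hyc] at hdc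
        exact absurd hdc (readBefore_irrefl _)
      · exact absurd (hdc.trans (h.readBefore i hi hil y hy z hz hlt c d hyc hzd))
          (readBefore_irrefl _)
  rw [← hcard, Nat.card_Ioo]
  omega

lemma standardize_destandardize (h : IsStandardized α γ e) :
    standardize α γ (destandardize α e) = e := by
  funext c
  ext y
  rw [mem_standardize]
  constructor
  · rintro ⟨i, hi, rfl⟩
    obtain ⟨⟨h1, h2⟩, y, hy, hyc⟩ := mem_destandardize.1 hi
    rwa [h.readRank_destandardize h1 h2 hy hyc]
  · intro hyc
    obtain ⟨i, h1, h2, h3⟩ :=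
      exists_mem_alphaBlock (h.filling.2.1 c y hyc) (h.le_sum c y hyc)
    exact ⟨i, mem_destandardize.2 ⟨⟨h1, h2⟩, y, h3, hyc⟩, h.readRank_destandardize h1 h2 h3 hyc⟩

end IsStandardized

namespace IsSVT

variable {α : List ℕ} {γ : YoungDiagram} {u : ℕ × ℕ → Finset ℕ}

lemma mem_shape (h : IsSVT α γ u) {i : ℕ} {c : ℕ × ℕ} (hi : i ∈ u c) : c ∈ γ :=
  (h.1.1 c).2 ⟨i, hi⟩

lemma mem_range (h : IsSVT α γ u) {i : ℕ} {c : ℕ × ℕ} (hi : i ∈ u c) : 1 ≤ i ∧ i ≤ α.length :=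
  ⟨h.1.2.1 c i hi, h.2.1 c i hi⟩

lemma readRank_lt_readRank (h : IsSVT α γ u) {i : ℕ} {c d : ℕ × ℕ} (hc : i ∈ u c)
    (hcd : ReadBefore c d) : readRank γ u i c < readRank γ u i d := by
  refine Finset.card_lt_card ((Finset.ssubset_iff_of_subset fun b hb => ?_).2 ⟨c, ?_, ?_⟩)
  · obtain ⟨h1, h2, h3⟩ := Finset.mem_filter.1 hb
    exact Finset.mem_filter.2 ⟨h1, h2, h3.trans hcd⟩
  · exact Finset.mem_filter.2 ⟨h.mem_shape hc, hc, hcd⟩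
  · exact fun hb => readBefore_irrefl c (Finset.mem_filter.1 hb).2.2

lemma readRank_lt (h : IsSVT α γ u) {i : ℕ} {c : ℕ × ℕ} (hc : i ∈ u c) :
    readRank γ u i c < α.getD (i - 1) 0 := by
  rw [← h.2.2 i (h.mem_range hc).1 (h.mem_range hc).2]
  refine Finset.card_lt_card ((Finset.ssubset_iff_of_subset fun b hb => ?_).2 ⟨c, ?_, ?_⟩)
  · obtain ⟨h1, h2, h3⟩ := Finset.mem_filter.1 hb
    exact Finset.mem_filter.2 ⟨h1, h2⟩
  · exact Finset.mem_filter.2 ⟨h.mem_shape hc, hc⟩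
  · exact fun hb => readBefore_irrefl c (Finset.mem_filter.1 hb).2.2

lemma eq_of_readRank_eq (h : IsSVT α γ u) {i : ℕ} {c d : ℕ × ℕ} (hc : i ∈ u c) (hd : i ∈ u d)
    (hcd : readRank γ u i c = readRank γ u i d) : c = d := by
  by_contra hne
  rcases readBefore_or_of_ne hne with hlt | hlt
  · exact (h.readRank_lt_readRank hc hlt).ne hcd
  · exact (h.readRank_lt_readRank hd hlt).ne' hcd

lemma exists_readRank_eq (h : IsSVT α γ u) {i m : ℕ} (hi : 1 ≤ i) (hil : i ≤ α.length)
    (hm : m < α.getD (i - 1) 0) : ∃ c, i ∈ u c ∧ readRank γ u i c = m := by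
  have himage : (γ.cells.filter fun c => i ∈ u c).image (readRank γ u i) =
      Finset.range (α.getD (i - 1) 0) := by
    refine Finset.eq_of_subset_of_card_le ?_ ?_
    · intro m hm
      obtain ⟨c, hc, rfl⟩ := Finset.mem_image.1 hm
      exact Finset.mem_range.2 (h.readRank_lt (Finset.mem_filter.1 hc).2)
    · rw [Finset.card_image_of_injOn, h.2.2 i hi hil, Finset.card_range]
      intro c hc d hd hcd
      exact h.eq_of_readRank_eq (Finset.mem_filter.1 hc).2 (Finset.mem_filter.1 hd).2 hcd
  obtain ⟨c, hc, hcm⟩ := Finset.mem_image.1 (himage ▸ Finset.mem_range.2 hm)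
  exact ⟨c, (Finset.mem_filter.1 hc).2, hcm⟩

lemma mem_alphaBlock (h : IsSVT α γ u) {i : ℕ} {c : ℕ × ℕ} (hc : i ∈ u c) :
    (α.take (i - 1)).sum + readRank γ u i c + 1 ∈ alphaBlock α i := by
  have h1 := h.readRank_lt hc
  have h2 := sum_take_succ_eq α (i - 1)
  rw [Nat.sub_add_cancel (h.mem_range hc).1] at h2
  refine AffineKTheory.mem_alphaBlock.2 ⟨by omega, by omega⟩

lemma mem_standardize_iff (h : IsSVT α γ u) {i y : ℕ} {c : ℕ × ℕ} (hy : y ∈ alphaBlock α i) :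
    y ∈ standardize α γ u c ↔ i ∈ u c ∧ (α.take (i - 1)).sum + readRank γ u i c + 1 = y := by
  rw [mem_standardize]
  constructor
  · rintro ⟨j, hj, rfl⟩
    obtain rfl := eq_of_mem_alphaBlock (h.mem_alphaBlock hj) hy
    exact ⟨hj, rfl⟩
  · rintro ⟨hi, hy⟩
    exact ⟨i, hi, hy⟩

lemma isStandardized_standardize (h : IsSVT α γ u) :
    IsStandardized α γ (standardize α γ u) where
  filling := by
    refine ⟨fun c => ?_, ?_, ?_, ?_⟩
    · rw [h.1.1 c, standardize, Finset.image_nonempty]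
    · intro c y hy
      obtain ⟨i, hi, rfl⟩ := mem_standardize.1 hy
      exact Nat.succ_pos _
    · intro r c y hy z hz
      obtain ⟨i, hi, rfl⟩ := mem_standardize.1 hy
      obtain ⟨j, hj, rfl⟩ := mem_standardize.1 hz
      exact lt_of_mem_alphaBlock_of_lt (h.1.2.2.1 r c i hi j hj) (h.mem_alphaBlock hi)
        (h.mem_alphaBlock hj)
    · intro r c y hy z hz
      obtain ⟨i, hi, rfl⟩ := mem_standardize.1 hy
      obtain ⟨j, hj, rfl⟩ := mem_standardize.1 hz
      rcases (h.1.2.2.2 r c i hi j hj).eq_or_lt with rfl | hlt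
      · have := h.readRank_lt_readRank (d := (r, c + 1)) hi (Or.inr ⟨rfl, c.lt_succ_self⟩)
        omega
      · exact (lt_of_mem_alphaBlock_of_lt hlt (h.mem_alphaBlock hi) (h.mem_alphaBlock hj)).le
  le_sum := by
    intro c y hy
    obtain ⟨i, hi, rfl⟩ := mem_standardize.1 hy
    exact (mem_Icc_of_mem_alphaBlock (h.mem_alphaBlock hi)).2
  existsUnique_cell := by
    intro x hx hxs
    obtain ⟨i, hi, hil, hxi⟩ := exists_mem_alphaBlock hx hxs
    have hxi' := AffineKTheory.mem_alphaBlock.1 hxi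
    have h2 := sum_take_succ_eq α (i - 1)
    rw [Nat.sub_add_cancel hi] at h2
    obtain ⟨c, hc, hcm⟩ := h.exists_readRank_eq (m := x - (α.take (i - 1)).sum - 1) hi hil
      (by omega)
    refine ⟨c, (h.mem_standardize_iff hxi).2 ⟨hc, by omega⟩, fun d hd => ?_⟩
    obtain ⟨h3, h4⟩ := (h.mem_standardize_iff hxi).1 hd
    exact h.eq_of_readRank_eq h3 hc (by omega)
  readBefore := by
    intro x hx hxl y hy z hz hyz c d hc hd
    obtain ⟨h1, rfl⟩ := (h.mem_standardize_iff hy).1 hc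
    obtain ⟨h2, rfl⟩ := (h.mem_standardize_iff hz).1 hd
    have hne : c ≠ d := by
      rintro rfl
      exact lt_irrefl _ hyz
    refine (readBefore_or_of_ne hne).resolve_right fun hdc => ?_
    have := h.readRank_lt_readRank h2 hdc
    omega
  strip := by
    rintro x hx hxl c d ⟨y, hy, hyc⟩ ⟨z, hz, hzd⟩ hcd
    have h1 := ((h.mem_standardize_iff hy).1 hyc).1
    have h2 := ((h.mem_standardize_iff hz).1 hzd).1
    obtain ⟨r, c⟩ := c
    obtain ⟨s, d⟩ := d
    obtain rfl : c = d := hcd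
    rcases lt_trichotomy r s with hlt | rfl | hlt
    · exact absurd (h.1.lt_of_col hlt h1 h2) (lt_irrefl _)
    · rfl
    · exact absurd (h.1.lt_of_col hlt h2 h1) (lt_irrefl _)

lemma destandardize_standardize (h : IsSVT α γ u) :
    destandardize α (standardize α γ u) = u := by
  funext c
  ext i
  rw [mem_destandardize]
  constructor
  · rintro ⟨-, y, hy, hyc⟩
    exact ((h.mem_standardize_iff hy).1 hyc).1
  · intro hi
    exact ⟨h.mem_range hi, _, h.mem_alphaBlock hi, mem_standardize.2 ⟨i, hi, rfl⟩⟩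

end IsSVT

/-- For a shape with at most `k` cells, affine set-valued tableaux are equinumerous with set-valued
tableaux of the same weight. -/
lemma Kcal_eq_KcalSV {k : ℕ} {μ : YoungDiagram} (hμ : μ.card ≤ k) (α : List ℕ) :
    Kcal k μ α = KcalSV μ α := by
  rw [Kcal, coreOf_eq_self hμ, KcalSV]
  exact Nat.card_congr
    { toFun := fun e => ⟨destandardize α e.1,
        ((isASVT_iff_isStandardized hμ).1 e.2).isSVT_destandardize⟩
      invFun := fun u => ⟨standardize α μ u.1,
        (isASVT_iff_isStandardized hμ).2 u.2.isStandardized_standardize⟩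
      left_inv := fun e => Subtype.ext
        ((isASVT_iff_isStandardized hμ).1 e.2).standardize_destandardize
      right_inv := fun u => Subtype.ext u.2.destandardize_standardize }

/-! ## Linear algebra -/

lemma hProd_eq_monomial (lam : YoungDiagram) :
    hProd lam = MvPolynomial.monomial (hExp lam) 1 := by
  have key : ∀ l : List ℕ, (∀ r ∈ l, 0 < r) → (l.map hSym).prod =
      MvPolynomial.monomial (Multiset.toFinsupp ((l : Multiset ℕ).map fun r => r - 1)) 1 := by
    intro l
    induction l with
    | nil => intro _; simp
    | cons r l ih =>
      intro hl
      obtain ⟨n, rfl⟩ := Nat.exists_eq_succ_of_ne_zero (hl r (by simp)).ne'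
      rw [List.map_cons, List.prod_cons, ih fun x hx => hl x (by simp [hx])]
      rw [← Multiset.cons_coe, Multiset.map_cons, ← Multiset.singleton_add, map_add,
        Multiset.toFinsupp_singleton, hSym, MvPolynomial.X, MvPolynomial.monomial_mul]
      simp
  exact key _ fun r hr => YoungDiagram.pos_of_mem_rowLens _ _ hr

lemma hExp_injective : Function.Injective hExp := by
  intro lam mu h
  have h1 := congrArg (Multiset.map (· + 1)) (Multiset.toFinsupp.injective h)
  have h2 : ∀ nu : YoungDiagram, Multiset.map (· + 1)
      ((nu.rowLens : Multiset ℕ).map fun r => r - 1) = nu.rowLens := by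
    intro nu
    rw [Multiset.map_map]
    conv_rhs => rw [← Multiset.map_id (nu.rowLens : Multiset ℕ)]
    refine Multiset.map_congr rfl fun r hr => ?_
    have := YoungDiagram.pos_of_mem_rowLens nu r (by simpa using hr)
    simp only [Function.comp, id]
    omega
  rw [h2, h2, Multiset.coe_eq_coe] at h1
  have h3 : lam.rowLens = mu.rowLens :=
    h1.eq_of_pairwise' lam.rowLens_sorted.pairwise mu.rowLens_sorted.pairwise
  exact YoungDiagram.equivListRowLens.injective (Subtype.ext h3)

lemma linearIndependent_hProd : LinearIndependent ℤ hProd := by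
  have h := (MvPolynomial.basisMonomials ℕ ℤ).linearIndependent.comp hExp hExp_injective
  rw [linearIndependent_iff'] at h ⊢
  intro s g hg i hi
  refine h s g ?_ i hi
  rw [← hg]
  refine Finset.sum_congr rfl fun j _ => ?_
  rw [hProd_eq_monomial, Function.comp_apply, MvPolynomial.coe_basisMonomials]

lemma finite_card_le (k : ℕ) : Finite {μ : YoungDiagram // μ.card ≤ k} := by
  have hsub : ∀ μ : {μ : YoungDiagram // μ.card ≤ k},
      μ.1.cells ∈ (Finset.range k ×ˢ Finset.range k).powerset := by
    rintro ⟨μ, hμ⟩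
    refine Finset.mem_powerset.2 fun c hc => ?_
    have := add_lt_card (γ := μ) hc hc
    simp only [Finset.mem_product, Finset.mem_range]
    omega
  refine Finite.of_injective (fun μ => (⟨_, hsub μ⟩ :
    (Finset.range k ×ˢ Finset.range k).powerset)) fun μ ν h => ?_
  exact Subtype.ext (YoungDiagram.ext (Subtype.ext_iff.1 h))

/-- Two families that express the same linearly independent family through the same square integer
matrix coincide. -/
lemma eq_of_linearIndependent_of_sum_eq {ι M : Type*} [Fintype ι]
    [AddCommGroup M] [Module.IsTorsionFree ℤ M] {a : ι → ι → ℤ} {h x y : ι → M}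
    (hh : LinearIndependent ℤ h) (hx : ∀ i, h i = ∑ j, a i j • x j)
    (hy : ∀ i, h i = ∑ j, a i j • y j) : x = y := by
  set A : Matrix ι ι ℤ := Matrix.of a with hA
  have hdet : A.det ≠ 0 := by
    intro h0
    obtain ⟨v, hv, hv0⟩ := Matrix.exists_vecMul_eq_zero_iff.2 h0
    refine hv (funext (Fintype.linearIndependent_iff.1 hh v ?_))
    simp only [hx, Finset.smul_sum, smul_smul]
    rw [Finset.sum_comm]
    refine Finset.sum_eq_zero fun j _ => ?_
    rw [← Finset.sum_smul]
    have := congrFun hv0 j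
    simp only [Matrix.vecMul, dotProduct, Pi.zero_apply, hA, Matrix.of_apply] at this
    rw [this, zero_smul]
  have hadj : ∀ (z : ι → M) (l : ι),
      ∑ i, A.adjugate l i • ∑ j, a i j • z j = A.det • z l := by
    intro z l
    simp only [Finset.smul_sum, smul_smul]
    rw [Finset.sum_comm]
    simp only [← Finset.sum_smul]
    have h1 : ∀ j, ∑ i, A.adjugate l i * a i j = (A.det • (1 : Matrix ι ι ℤ)) l j := by
      intro j
      rw [← Matrix.adjugate_mul, Matrix.mul_apply]
      simp only [hA, Matrix.of_apply]
    simp only [h1, Matrix.smul_apply, Matrix.one_apply]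
    simp
  funext l
  have := (hadj x l).symm.trans
    ((Finset.sum_congr rfl fun i _ => by rw [← hx i, hy i]).trans (hadj y l))
  exact smul_right_injective M hdet this

lemma finsum_eq_sum_subtype {ι M : Type*} [AddCommMonoid M] {p : ι → Prop} [Fintype {i // p i}]
    {f : ι → M} (h : ∀ i, ¬ p i → f i = 0) : ∑ᶠ i, f i = ∑ i : {i // p i}, f i := by
  rw [← finsum_eq_sum_of_fintype, finsum_subtype_eq_finsum_cond p]
  refine finsum_congr fun i => ?_
  by_cases hi : p i
  · simp [hi]
  · simp [hi, h i hi]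

/-- For any `k`-bounded partition `λ` with `|λ| ≤ k`, the `k`-`K`-Schur
function equals the dual Grothendieck polynomial: `g^{(k)}_λ = g_λ` in `Λ`. -/
theorem kKSchur_eq_dualGrothendieck_of_small
    (k : ℕ) (hk : 1 ≤ k)
    (g : YoungDiagram → SymFunc) (hg : KKSchurSystem k g)
    (gd : YoungDiagram → SymFunc) (hgd : DualGrothSystem gd)
    (lam : YoungDiagram) (hlam : IsKBounded k lam) (hcard : lam.card ≤ k) :
    g lam = gd lam := by
  have := finite_card_le k
  have := Fintype.ofFinite {μ : YoungDiagram // μ.card ≤ k}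
  have hb : ∀ μ : YoungDiagram, μ.card ≤ k → IsKBounded k μ := by
    intro μ hμ i
    rw [YoungDiagram.rowLen_eq_card]
    exact (Finset.card_le_card (Finset.filter_subset _ _)).trans hμ
  let a : YoungDiagram → YoungDiagram → ℤ := fun ν μ => if μ.card ≤ ν.card then
      (-1 : ℤ) ^ (μ.card + ν.card) * (KcalSV μ ν.rowLens : ℤ) else 0
  have hx : ∀ ν : {μ : YoungDiagram // μ.card ≤ k},
      hProd ν.1 = ∑ μ : {μ : YoungDiagram // μ.card ≤ k}, a ν μ • gd μ.1 := by
    rintro ⟨ν, hν⟩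
    rw [hgd ν, finsum_eq_sum_subtype (p := fun μ => μ.card ≤ k)
      fun μ hμ => if_neg fun h => hμ (h.trans hν)]
    refine Finset.sum_congr rfl fun μ _ => ?_
    simp only [a, ite_smul, zero_smul]
  have hy : ∀ ν : {μ : YoungDiagram // μ.card ≤ k},
      hProd ν.1 = ∑ μ : {μ : YoungDiagram // μ.card ≤ k}, a ν μ • g μ.1 := by
    rintro ⟨ν, hν⟩
    rw [hg.2 ν (hb ν hν), finsum_eq_sum_subtype (p := fun μ => μ.card ≤ k)
      fun μ hμ => if_neg fun h => hμ (h.2.trans hν)]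
    refine Finset.sum_congr rfl fun μ _ => ?_
    simp only [a, ite_smul, zero_smul, hb μ.1 μ.2, true_and, Kcal_eq_KcalSV μ.2,
      add_comm ν.card]
  exact congrFun (eq_of_linearIndependent_of_sum_eq (linearIndependent_hProd.comp
    ((↑) : {μ : YoungDiagram // μ.card ≤ k} → YoungDiagram) Subtype.val_injective) hy hx)
    ⟨lam, hcard⟩

end AffineKTheory
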